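/- arXiv:1907.05341 — 8 statements merged into one kernel-verified Lean document; each statement's English description precedes it below -/
import Mathlib

section
/- Let H be a real inner product space, let B : H → H be a symmetric continuous linear operator, and let N : H → H be a negative semi-definite continuous linear operator. Let Δt > 0 and suppose Ψ⁰, Ψ¹ ∈ H satisfy the Crank–Nicolson correction relation (Ψ¹ − Ψ⁰)/Δt = N(B((Ψ¹ + Ψ⁰)/2)). Then, writing m = (Ψ¹ + Ψ⁰)/2 and F(x) = (1/2)⟨x, B x⟩, one has (F(Ψ¹) − F(Ψ⁰))/Δt = ⟨B m, N(B m)⟩ ≤ 0. -/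
open scoped RealInnerProductSpace

theorem cn_correction_energy_dissipation
    {H : Type*} [NormedAddCommGroup H] [InnerProductSpace ℝ H]
    (B : H →L[ℝ] H) (hB : ∀ x y : H, ⟪B x, y⟫ = ⟪x, B y⟫)
    (N : H →L[ℝ] H) (hN : ∀ v : H, ⟪N v, v⟫ ≤ 0)
    (Δt : ℝ) (hΔt : 0 < Δt) (Ψ0 Ψ1 : H)
    (hscheme : (Δt)⁻¹ • (Ψ1 - Ψ0) = N (B ((2:ℝ)⁻¹ • (Ψ1 + Ψ0))))
    (m : H) (hm : m = (2:ℝ)⁻¹ • (Ψ1 + Ψ0))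
    (F : H → ℝ) (hF : ∀ x : H, F x = (1/2) * ⟪x, B x⟫) :
    (F Ψ1 - F Ψ0) / Δt = ⟪B m, N (B m)⟫ ∧ ⟪B m, N (B m)⟫ ≤ 0 := by
  refine ⟨?_, by rw [real_inner_comm]; exact hN (B m)⟩
  have hcross : ⟪Ψ1, B Ψ0⟫ = ⟪Ψ0, B Ψ1⟫ := by rw [← hB, real_inner_comm]
  rw [hm, ← hscheme, hF, hF, hB]
  simp only [map_smul, map_sub, inner_smul_left, inner_smul_right, inner_add_left,
    inner_sub_right, conj_trivial]
  rw [hcross]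
  ring
end

section
/- Let H be a real inner product space, let B : H → H be a symmetric continuous linear operator, and let N : H → H be a negative semi-definite continuous linear operator. Let Δt > 0 and suppose Ψ⁰, Ψ¹ ∈ H satisfy (Ψ¹ − Ψ⁰)/Δt = N(B((Ψ¹ + Ψ⁰)/2)). Then the modified energy decays: F(Ψ¹) ≤ F(Ψ⁰), where F(x) = (1/2)⟨x, B x⟩. In particular the Crank–Nicolson correction scheme is unconditionally energy stable (the inequality holds for every time step Δt > 0). -/
open scoped RealInnerProductSpace

theorem cn_correction_unconditional_energy_stability
    {H : Type*} [NormedAddCommGroup H] [InnerProductSpace ℝ H]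
    (B : H →L[ℝ] H) (hB : ∀ x y : H, ⟪B x, y⟫ = ⟪x, B y⟫)
    (N : H →L[ℝ] H) (hN : ∀ v : H, ⟪N v, v⟫ ≤ 0)
    (Δt : ℝ) (hΔt : 0 < Δt) (Ψ0 Ψ1 : H)
    (hscheme : (Δt)⁻¹ • (Ψ1 - Ψ0) = N (B ((2:ℝ)⁻¹ • (Ψ1 + Ψ0))))
    (F : H → ℝ) (hF : ∀ x : H, F x = (1/2) * ⟪x, B x⟫) :
    F Ψ1 ≤ F Ψ0 := by
  have hdiss := hN (B ((2 : ℝ)⁻¹ • (Ψ1 + Ψ0)))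
  rw [← hscheme, real_inner_smul_left, map_smul, real_inner_smul_right] at hdiss
  have hle : ⟪Ψ1 - Ψ0, B (Ψ1 + Ψ0)⟫ ≤ 0 := by
    have := nonpos_of_mul_nonpos_right hdiss (inv_pos.mpr hΔt)
    linarith
  have hcross : ⟪Ψ1, B Ψ0⟫ = ⟪Ψ0, B Ψ1⟫ := by
    rw [← hB, real_inner_comm]
  rw [map_add, inner_sub_left, inner_add_right, inner_add_right] at hle
  rw [hF, hF]
  linarith
end

section
/- Let H be a real inner product space and let B : H → H be a symmetric continuous linear operator. Then for all a, b, c ∈ H the following identity holds: 2⟨3a − 4b + c, B a⟩ = ⟨a, B a⟩ + ⟨2a − b, B(2a − b)⟩ − ⟨b, B b⟩ − ⟨2b − c, B(2b − c)⟩ + ⟨a − 2b + c, B(a − 2b + c)⟩. -/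
open scoped RealInnerProductSpace

theorem bdf2_algebraic_identity
    {H : Type*} [NormedAddCommGroup H] [InnerProductSpace ℝ H]
    (B : H →L[ℝ] H) (hB : ∀ x y : H, ⟪B x, y⟫ = ⟪x, B y⟫)
    (a b c : H) :
    2 * ⟪(3:ℝ) • a - (4:ℝ) • b + c, B a⟫ =
      ⟪a, B a⟫ + ⟪(2:ℝ) • a - b, B ((2:ℝ) • a - b)⟫
        - ⟪b, B b⟫ - ⟪(2:ℝ) • b - c, B ((2:ℝ) • b - c)⟫
        + ⟪a - (2:ℝ) • b + c, B (a - (2:ℝ) • b + c)⟫ := by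
  have symm (x y : H) : ⟪x, B y⟫ = ⟪y, B x⟫ := by rw [← hB, real_inner_comm]
  simp only [map_add, map_sub, map_smul, inner_add_left, inner_add_right, inner_sub_left,
    inner_sub_right, real_inner_smul_left, real_inner_smul_right]
  rw [symm b a, symm c a, symm c b]
  ring
end

section
/- Let H be a real inner product space, let B : H → H be a symmetric continuous linear operator, and let N : H → H be a negative semi-definite continuous linear operator. Let Δt > 0 and suppose Ψ⁰, Ψ¹, Ψ² ∈ H satisfy the BDF2 correction relation (3Ψ² − 4Ψ¹ + Ψ⁰)/(2Δt) = N(B Ψ²). Define G(a, b) = (1/4)(⟨a, B a⟩ + ⟨2a − b, B(2a − b)⟩) and F̃ = (1/4)⟨Ψ² − 2Ψ¹ + Ψ⁰, B(Ψ² − 2Ψ¹ + Ψ⁰)⟩. Then (G(Ψ², Ψ¹) − G(Ψ¹, Ψ⁰) + F̃)/Δt = ⟨B Ψ², N(B Ψ²)⟩ ≤ 0. -/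
open scoped RealInnerProductSpace

theorem bdf2_correction_energy_identity
    {H : Type*} [NormedAddCommGroup H] [InnerProductSpace ℝ H]
    (B : H →L[ℝ] H) (hB : ∀ x y : H, ⟪B x, y⟫ = ⟪x, B y⟫)
    (N : H →L[ℝ] H) (hN : ∀ v : H, ⟪N v, v⟫ ≤ 0)
    (Δt : ℝ) (hΔt : 0 < Δt) (Ψ0 Ψ1 Ψ2 : H)
    (hscheme : (2 * Δt)⁻¹ • ((3:ℝ) • Ψ2 - (4:ℝ) • Ψ1 + Ψ0) = N (B Ψ2))
    (G : H → H → ℝ)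
    (hG : ∀ a b : H, G a b = (1/4) * (⟪a, B a⟫ + ⟪(2:ℝ) • a - b, B ((2:ℝ) • a - b)⟫))
    (Ftil : ℝ)
    (hFtil : Ftil = (1/4) * ⟪Ψ2 - (2:ℝ) • Ψ1 + Ψ0, B (Ψ2 - (2:ℝ) • Ψ1 + Ψ0)⟫) :
    (G Ψ2 Ψ1 - G Ψ1 Ψ0 + Ftil) / Δt = ⟪B Ψ2, N (B Ψ2)⟫ ∧ ⟪B Ψ2, N (B Ψ2)⟫ ≤ 0 := by
  have symm (x y : H) : ⟪x, B y⟫ = ⟪y, B x⟫ := by rw [← hB, real_inner_comm]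
  refine ⟨?_, by rw [real_inner_comm]; exact hN _⟩
  have hΔt0 : Δt ≠ 0 := hΔt.ne'
  rw [← hscheme, hG, hG, hFtil, real_inner_smul_right, hB]
  simp only [map_add, map_sub, map_smul, inner_add_left, inner_add_right, inner_sub_left,
    inner_sub_right, real_inner_smul_left, real_inner_smul_right]
  rw [symm Ψ1 Ψ0, symm Ψ2 Ψ0, symm Ψ2 Ψ1]
  field_simp
  ring
end

section
/- Let H be a real inner product space, let B : H → H be a symmetric continuous linear operator that is additionally positive semi-definite (⟨B v, v⟩ ≥ 0 for all v), and let N : H → H be a negative semi-definite continuous linear operator. Let Δt > 0 and suppose Ψ⁰, Ψ¹, Ψ² ∈ H satisfy (3Ψ² − 4Ψ¹ + Ψ⁰)/(2Δt) = N(B Ψ²). Then with G(a, b) = (1/4)(⟨a, B a⟩ + ⟨2a − b, B(2a − b)⟩) one has the energy decay G(Ψ², Ψ¹) ≤ G(Ψ¹, Ψ⁰); i.e., the BDF2 correction scheme is unconditionally energy stable. -/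
open scoped RealInnerProductSpace

theorem bdf2_correction_unconditional_energy_stability
    {H : Type*} [NormedAddCommGroup H] [InnerProductSpace ℝ H]
    (B : H →L[ℝ] H) (hB : ∀ x y : H, ⟪B x, y⟫ = ⟪x, B y⟫)
    (hBpos : ∀ v : H, 0 ≤ ⟪B v, v⟫)
    (N : H →L[ℝ] H) (hN : ∀ v : H, ⟪N v, v⟫ ≤ 0)
    (Δt : ℝ) (hΔt : 0 < Δt) (Ψ0 Ψ1 Ψ2 : H)
    (hscheme : (2 * Δt)⁻¹ • ((3:ℝ) • Ψ2 - (4:ℝ) • Ψ1 + Ψ0) = N (B Ψ2))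
    (G : H → H → ℝ)
    (hG : ∀ a b : H, G a b = (1/4) * (⟪a, B a⟫ + ⟪(2:ℝ) • a - b, B ((2:ℝ) • a - b)⟫)) :
    G Ψ2 Ψ1 ≤ G Ψ1 Ψ0 := by
  have hdiff : ⟪(3:ℝ) • Ψ2 - (4:ℝ) • Ψ1 + Ψ0, B Ψ2⟫ ≤ 0 := by
    have h := hN (B Ψ2)
    rw [← hscheme, real_inner_smul_left] at h
    exact nonpos_of_mul_nonpos_right h (by positivity)
  have hsq := hBpos (Ψ2 - (2:ℝ) • Ψ1 + Ψ0)
  have h01 : ⟪Ψ0, B Ψ1⟫ = ⟪Ψ1, B Ψ0⟫ := by rw [← hB, real_inner_comm]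
  have h02 : ⟪Ψ0, B Ψ2⟫ = ⟪Ψ2, B Ψ0⟫ := by rw [← hB, real_inner_comm]
  have h12 : ⟪Ψ1, B Ψ2⟫ = ⟪Ψ2, B Ψ1⟫ := by rw [← hB, real_inner_comm]
  rw [hB] at hsq
  rw [hG, hG]
  simp only [map_add, map_sub, map_smul, inner_add_left, inner_add_right, inner_sub_left,
    inner_sub_right, real_inner_smul_left, real_inner_smul_right] at hdiff hsq ⊢
  linarith
end

section
/- Let H be a real inner product space, let B : H → H be a symmetric continuous linear operator, let s be a positive integer, Δt > 0, and let a : Fin s → Fin s → ℝ and b : Fin s → ℝ be reals. Let Ψⁿ ∈ H, let k₁, …, k_s ∈ H be arbitrary, set Ψᵢ = Ψⁿ + Δt ∑ⱼ aᵢⱼ kⱼ for each i, and Ψⁿ⁺¹ = Ψⁿ + Δt ∑ᵢ bᵢ kᵢ. Then with F(x) = (1/2)⟨x, B x⟩ one has F(Ψⁿ⁺¹) − F(Ψⁿ) = Δt ∑ᵢ bᵢ ⟨kᵢ, B Ψᵢ⟩ + (Δt²/2) ∑ᵢ ∑ⱼ (bᵢ bⱼ − bᵢ aᵢⱼ − bⱼ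 aⱼᵢ) ⟨kᵢ, B kⱼ⟩. -/
open scoped RealInnerProductSpace

theorem inner_map_add_smul_self {H : Type*} [NormedAddCommGroup H] [InnerProductSpace ℝ H]
    (B : H →L[ℝ] H) (hB : ∀ x y : H, ⟪B x, y⟫ = ⟪x, B y⟫) (x v : H) (t : ℝ) :
    ⟪x + t • v, B (x + t • v)⟫ = ⟪x, B x⟫ + 2 * t * ⟪v, B x⟫ + t ^ 2 * ⟪v, B v⟫ := by
  have hsymm : ⟪x, B v⟫ = ⟪v, B x⟫ := by rw [← hB, real_inner_comm]
  simp only [map_add, map_smul, inner_add_left, inner_add_right, real_inner_smul_left,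
    real_inner_smul_right, hsymm]
  ring

theorem rk_energy_expansion_identity_two
    {H : Type*} [NormedAddCommGroup H] [InnerProductSpace ℝ H]
    (B : H →L[ℝ] H) (hB : ∀ x y : H, ⟪B x, y⟫ = ⟪x, B y⟫)
    (s : ℕ) (hs : 0 < s) (Δt : ℝ) (hΔt : 0 < Δt)
    (a : Fin s → Fin s → ℝ) (b : Fin s → ℝ)
    (Ψn : H) (k : Fin s → H)
    (Ψstage : Fin s → H) (hΨstage : ∀ i, Ψstage i = Ψn + Δt • ∑ j, a i j • k j)
    (Ψnp1 : H) (hΨnp1 : Ψnp1 = Ψn + Δt • ∑ i, b i • k i)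
    (F : H → ℝ) (hF : ∀ x : H, F x = (1/2) * ⟪x, B x⟫) :
    F Ψnp1 - F Ψn =
      Δt * ∑ i, b i * ⟪k i, B (Ψstage i)⟫
        + (Δt ^ 2 / 2) *
            ∑ i, ∑ j, (b i * b j - b i * a i j - b j * a j i) * ⟪k i, B (k j)⟫ := by
  have hsymm (i j : Fin s) : ⟪k j, B (k i)⟫ = ⟪k i, B (k j)⟫ := by
    rw [← hB, real_inner_comm]
  have hswap : ∑ i, ∑ j, b j * a j i * ⟪k i, B (k j)⟫ =
      ∑ i, ∑ j, b i * a i j * ⟪k i, B (k j)⟫ := by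
    rw [Finset.sum_comm]
    exact Finset.sum_congr rfl fun i _ => Finset.sum_congr rfl fun j _ => by rw [hsymm]
  have hlin : ⟪∑ i, b i • k i, B Ψn⟫ = ∑ i, b i * ⟪k i, B Ψn⟫ := by
    simp only [sum_inner, real_inner_smul_left]
  have hquad : ⟪∑ i, b i • k i, B (∑ i, b i • k i)⟫ =
      ∑ i, ∑ j, b i * b j * ⟪k i, B (k j)⟫ := by
    simp only [map_sum, map_smul, sum_inner, inner_sum, real_inner_smul_left,
      real_inner_smul_right, mul_assoc]
    exact Finset.sum_congr rfl fun i _ => Finset.sum_congr rfl fun j _ => by rw [hsymm i j]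
  have hstage : ∑ i, b i * ⟪k i, B (Ψstage i)⟫ =
      ∑ i, b i * ⟪k i, B Ψn⟫ + Δt * ∑ i, ∑ j, b i * a i j * ⟪k i, B (k j)⟫ := by
    rw [Finset.mul_sum, ← Finset.sum_add_distrib]
    refine Finset.sum_congr rfl fun i _ => ?_
    simp only [hΨstage, map_add, map_smul, map_sum, inner_add_right, inner_sum,
      real_inner_smul_right, mul_add, Finset.mul_sum]
    congr 1
    exact Finset.sum_congr rfl fun j _ => by ring
  rw [hF, hF, hΨnp1, inner_map_add_smul_self B hB, hlin, hquad, hstage]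
  simp only [sub_mul, Finset.sum_sub_distrib]
  rw [hswap]
  ring
end

section
/- Let H be a real inner product space, let B : H → H be a symmetric continuous linear operator, let s be a positive integer, and let a : Fin s → Fin s → ℝ and b : Fin s → ℝ be the coefficients of an s-stage Runge–Kutta method satisfying bᵢ aᵢⱼ + bⱼ aⱼᵢ = bᵢ bⱼ and bᵢ ≥ 0 for all i, j. Let N₁, …, N_s : H → H be negative semi-definite continuous linear operators, let Δt > 0, let Ψⁿ ∈ H, and suppose k₁, …, k_s ∈ H satisfy the stage equations kᵢ = Nᵢ(B Ψᵢ) where Ψᵢ = Ψⁿ + Δt ∑ⱼ aᵢⱼ kⱼ, and set Ψⁿ⁺¹ = Ψⁿ + Δt ∑ᵢ bᵢ kᵢ. Then with F(x) = (1/2)⟨x, B x⟩ one has F(Ψⁿ⁺¹) − F(Ψⁿ) = Δt ∑ᵢ bᵢ ⟨B Ψᵢ, Nᵢ(B Ψᵢ)⟩ ≤ 0; i.e., the Runge–Kutta scheme for the energy-quadratized system is unconditionally energy stable. -/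
open scoped RealInnerProductSpace

/-- For Runge–Kutta coefficients with `bᵢ aᵢⱼ + bⱼ aⱼᵢ = bᵢ bⱼ`, the double sum of a symmetric array
weighted by `bᵢ bⱼ` is twice the one weighted by `bᵢ aᵢⱼ`. -/
theorem sum_sum_mul_eq_two_mul_of_symplectic {ι R : Type*} [Fintype ι] [CommRing R]
    {a : ι → ι → R} {b : ι → R} (hab : ∀ i j, b i * a i j + b j * a j i = b i * b j)
    {g : ι → ι → R} (hg : ∀ i j, g i j = g j i) :
    ∑ i, ∑ j, b i * b j * g i j = 2 * ∑ i, ∑ j, b i * a i j * g i j := by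
  have hswap : ∑ i, ∑ j, b j * a j i * g i j = ∑ i, ∑ j, b i * a i j * g i j := by
    rw [Finset.sum_comm]
    simp only [hg]
  simp only [← hab, add_mul, Finset.sum_add_distrib, hswap, two_mul]

/-- Increment of the quadratic form of a symmetric operator. -/
theorem inner_add_map_add_of_symmetric {H : Type*} [NormedAddCommGroup H] [InnerProductSpace ℝ H]
    {B : H →L[ℝ] H} (hB : ∀ x y : H, ⟪B x, y⟫ = ⟪x, B y⟫) (x y : H) :
    ⟪x + y, B (x + y)⟫ = ⟪x, B x⟫ + 2 * ⟪y, B x⟫ + ⟪y, B y⟫ := by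
  rw [map_add, inner_add_left, inner_add_right, inner_add_right, ← hB x y,
    real_inner_comm y (B x)]
  ring

theorem heq_rk_energy_dissipation
    {H : Type*} [NormedAddCommGroup H] [InnerProductSpace ℝ H]
    (B : H →L[ℝ] H) (hB : ∀ x y : H, ⟪B x, y⟫ = ⟪x, B y⟫)
    (s : ℕ) (hs : 0 < s)
    (a : Fin s → Fin s → ℝ) (b : Fin s → ℝ)
    (hab : ∀ i j, b i * a i j + b j * a j i = b i * b j)
    (hb : ∀ i, 0 ≤ b i)
    (N : Fin s → (H →L[ℝ] H)) (hN : ∀ i, ∀ v : H, ⟪N i v, v⟫ ≤ 0)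
    (Δt : ℝ) (hΔt : 0 < Δt) (Ψn : H) (k : Fin s → H)
    (Ψstage : Fin s → H) (hΨstage : ∀ i, Ψstage i = Ψn + Δt • ∑ j, a i j • k j)
    (hstage : ∀ i, k i = N i (B (Ψstage i)))
    (Ψnp1 : H) (hΨnp1 : Ψnp1 = Ψn + Δt • ∑ i, b i • k i)
    (F : H → ℝ) (hF : ∀ x : H, F x = (1/2) * ⟪x, B x⟫) :
    F Ψnp1 - F Ψn = Δt * ∑ i, b i * ⟪B (Ψstage i), N i (B (Ψstage i))⟫ ∧
      Δt * ∑ i, b i * ⟪B (Ψstage i), N i (B (Ψstage i))⟫ ≤ 0 := by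
  subst hΨnp1
  have hsymm : ∀ i j, ⟪k i, B (k j)⟫ = ⟪k j, B (k i)⟫ := fun i j => by
    rw [← hB, real_inner_comm]
  constructor
  · have hstage_inner : ∀ i, ⟪B (Ψstage i), N i (B (Ψstage i))⟫ =
        ⟪k i, B Ψn⟫ + Δt * ∑ j, a i j * ⟪k i, B (k j)⟫ := fun i => by
      rw [← hstage i, real_inner_comm, hΨstage i]
      simp [inner_add_right, inner_sum, real_inner_smul_right]
    have hlin : ⟪∑ i, b i • k i, B Ψn⟫ = ∑ i, b i * ⟪k i, B Ψn⟫ := by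
      simp [sum_inner, real_inner_smul_left]
    have hquad : ⟪∑ i, b i • k i, B (∑ i, b i • k i)⟫ =
        2 * ∑ i, ∑ j, b i * a i j * ⟪k i, B (k j)⟫ := by
      rw [← sum_sum_mul_eq_two_mul_of_symplectic hab hsymm]
      simp [sum_inner, inner_sum, real_inner_smul_left, real_inner_smul_right, mul_assoc]
      exact Finset.sum_congr rfl fun i _ => Finset.sum_congr rfl fun j _ => by rw [hsymm]
    have hsum : ∑ i, b i * ⟪B (Ψstage i), N i (B (Ψstage i))⟫ =
        ∑ i, b i * ⟪k i, B Ψn⟫ + Δt * ∑ i, ∑ j, b i * a i j * ⟪k i, B (k j)⟫ := by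
      simp only [hstage_inner, mul_add, Finset.sum_add_distrib, Finset.mul_sum]
      congr! 3
      ring
    rw [hF, hF, inner_add_map_add_of_symmetric hB, map_smul, real_inner_smul_left,
      real_inner_smul_left, real_inner_smul_right, hlin, hquad, hsum]
    ring
  · refine mul_nonpos_of_nonneg_of_nonpos hΔt.le (Finset.sum_nonpos fun i _ => ?_)
    rw [real_inner_comm]
    exact mul_nonpos_of_nonneg_of_nonpos (hb i) (hN i _)
end

section
/- Let H be a real inner product space, B : H → H a symmetric continuous linear operator, s a positive integer, and for each i ∈ Fin s let cᵢ ∈ ℝ and bᵢ ≥ 0 be quadrature nodes and weights such that the quadrature rule is exact for real polynomials of degree at most 2s − 1, i.e. ∫₀¹ p(x) dx = ∑ᵢ bᵢ p(cᵢ) for every real polynomial p of degree ≤ 2s − 1. Let Δt > 0, tₙ ∈ ℝ, let v₀, …, v_s ∈ H, define the collocation polynomial u(t) = ∑_{j=0}^{s} ((t − tₙ)/Δt)ʲ • vⱼ with derivative u'(t) = ∑_{j=1}^{s} (j/Δt) ((t − tₙ)/Δt)^{j−1} • vⱼ, and suppose u satisfies the collocation conditions u'(tₙ + cᵢ Δt)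 = Nᵢ(B(u(tₙ + cᵢ Δt))) for each i, where each Nᵢ : H → H is a negative semi-definite continuous linear operator. Then, with F(x) = (1/2)⟨x, B x⟩, one has F(u(tₙ + Δt)) − F(u(tₙ)) = Δt ∑ᵢ bᵢ ⟨B(u(tₙ + cᵢ Δt)), Nᵢ(B(u(tₙ + cᵢ Δt)))⟩ ≤ 0; i.e., the s-stage Gaussian collocation scheme for the energy-quadratized system is unconditionally energy stable. -/
open scoped RealInnerProductSpace

/-- The derivative of a vector-valued polynomial. -/
theorem hasDerivAt_sum_pow_smul {E : Type*} [NormedAddCommGroup E] [NormedSpace ℝ E]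
    (S : Finset ℕ) (v : ℕ → E) (x : ℝ) :
    HasDerivAt (fun x : ℝ => ∑ j ∈ S, x ^ j • v j) (∑ j ∈ S, ((j : ℝ) * x ^ (j - 1)) • v j) x :=
  HasDerivAt.fun_sum fun j _ => (hasDerivAt_pow j x).smul_const (v j)

/-- The energy `⟪w, B w⟫ / 2` of a symmetric operator has derivative `⟪B w, w'⟫` along a curve. -/
theorem HasDerivAt.half_inner_apply_self {H : Type*} [NormedAddCommGroup H]
    [InnerProductSpace ℝ H] {B : H →L[ℝ] H} (hB : ∀ x y : H, ⟪B x, y⟫ = ⟪x, B y⟫)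
    {w : ℝ → H} {w' : H} {x : ℝ} (hw : HasDerivAt w w' x) :
    HasDerivAt (fun x => (1 / 2) * ⟪w x, B (w x)⟫) ⟪B (w x), w'⟫ x := by
  have h := (hw.inner ℝ (B.hasFDerivAt.comp_hasDerivAt x hw)).const_mul (1 / 2 : ℝ)
  refine h.congr_deriv ?_
  simp only [Function.comp_apply]
  rw [← hB, real_inner_comm w']
  ring

/-- The energy along a vector-valued polynomial of degree at most `s` is a real polynomial of
degree at most `2 * s`. -/
theorem exists_polynomial_eval_eq_inner_sum_pow_smul {H : Type*} [NormedAddCommGroup H]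
    [InnerProductSpace ℝ H] (B : H →L[ℝ] H) (s : ℕ) (v : ℕ → H) :
    ∃ G : Polynomial ℝ, G.natDegree ≤ 2 * s ∧ ∀ x : ℝ, G.eval x =
      (1 / 2) * ⟪∑ j ∈ Finset.range (s + 1), x ^ j • v j,
        B (∑ j ∈ Finset.range (s + 1), x ^ j • v j)⟫ := by
  refine ⟨∑ j ∈ Finset.range (s + 1), ∑ k ∈ Finset.range (s + 1),
    Polynomial.C ((1 / 2) * ⟪v j, B (v k)⟫) * Polynomial.X ^ (j + k), ?_, fun x => ?_⟩
  · refine Polynomial.natDegree_sum_le_of_forall_le _ _ fun j hj =>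
      Polynomial.natDegree_sum_le_of_forall_le _ _ fun k hk =>
      (Polynomial.natDegree_C_mul_X_pow_le _ _).trans ?_
    rw [Finset.mem_range] at hj hk
    omega
  · simp only [Polynomial.eval_finsetSum, Polynomial.eval_mul, Polynomial.eval_C,
      Polynomial.eval_pow, Polynomial.eval_X, map_sum, map_smul, sum_inner, inner_sum,
      real_inner_smul_left, real_inner_smul_right, Finset.mul_sum]
    rw [Finset.sum_comm]
    refine Finset.sum_congr rfl fun j _ => Finset.sum_congr rfl fun k _ => ?_
    ring

theorem gaussian_collocation_energy_dissipation
    {H : Type*} [NormedAddCommGroup H] [InnerProductSpace ℝ H]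
    (B : H →L[ℝ] H) (hB : ∀ x y : H, ⟪B x, y⟫ = ⟪x, B y⟫)
    (s : ℕ) (hs : 0 < s)
    (c : Fin s → ℝ) (b : Fin s → ℝ) (hb : ∀ i, 0 ≤ b i)
    (hquad : ∀ p : Polynomial ℝ, p.natDegree ≤ 2 * s - 1 →
      (∫ x in (0:ℝ)..1, p.eval x) = ∑ i, b i * p.eval (c i))
    (Δt : ℝ) (hΔt : 0 < Δt) (tn : ℝ) (v : ℕ → H)
    (u : ℝ → H) (hu : ∀ t : ℝ, u t = ∑ j ∈ Finset.range (s + 1), ((t - tn) / Δt) ^ j • v j)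
    (u' : ℝ → H)
    (hu' : ∀ t : ℝ, u' t =
      ∑ j ∈ Finset.Icc 1 s, (((j : ℝ) / Δt) * ((t - tn) / Δt) ^ (j - 1)) • v j)
    (N : Fin s → (H →L[ℝ] H)) (hN : ∀ i, ∀ w : H, ⟪N i w, w⟫ ≤ 0)
    (hcolloc : ∀ i, u' (tn + c i * Δt) = N i (B (u (tn + c i * Δt))))
    (F : H → ℝ) (hF : ∀ x : H, F x = (1/2) * ⟪x, B x⟫) :
    F (u (tn + Δt)) - F (u tn) =
      Δt * ∑ i, b i * ⟪B (u (tn + c i * Δt)), N i (B (u (tn + c i * Δt)))⟫ ∧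
    Δt * ∑ i, b i * ⟪B (u (tn + c i * Δt)), N i (B (u (tn + c i * Δt)))⟫ ≤ 0 := by
  set w : ℝ → H := fun x => ∑ j ∈ Finset.range (s + 1), x ^ j • v j with hw
  have hu_w (x : ℝ) : u (tn + x * Δt) = w x := by
    simp [hu, hw, hΔt.ne']
  have hderiv (x : ℝ) : HasDerivAt w (Δt • u' (tn + x * Δt)) x := by
    refine (hasDerivAt_sum_pow_smul (Finset.range (s + 1)) v x).congr_deriv ?_
    rw [hu', Finset.smul_sum, Finset.range_eq_Ico, Finset.sum_eq_sum_Ico_succ_bot (by omega)]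
    simp only [Nat.cast_zero, zero_mul, zero_smul, zero_add]
    refine Finset.sum_congr rfl fun j _ => ?_
    rw [smul_smul, add_sub_cancel_left, mul_div_cancel_right₀ _ hΔt.ne']
    congr 1
    field_simp
  obtain ⟨G, hdeg, hG⟩ := exists_polynomial_eval_eq_inner_sum_pow_smul B s v
  have hG' (x : ℝ) : G.derivative.eval x = Δt * ⟪B (w x), u' (tn + x * Δt)⟫ := by
    rw [← real_inner_smul_right]
    refine (G.hasDerivAt x).unique ?_
    rw [funext hG]
    exact (hderiv x).half_inner_apply_self hB
  have hint : (∫ x in (0:ℝ)..1, G.derivative.eval x) = G.eval 1 - G.eval 0 :=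
    intervalIntegral.integral_eq_sub_of_hasDerivAt (fun x _ => G.hasDerivAt x)
      (G.derivative.continuous.intervalIntegrable _ _)
  have hexact := hquad G.derivative ((Polynomial.natDegree_derivative_le G).trans (by omega))
  have h0 : u tn = w 0 := by simpa using hu_w 0
  have h1 : u (tn + Δt) = w 1 := by simpa using hu_w 1
  refine ⟨?_, mul_nonpos_of_nonneg_of_nonpos hΔt.le <| Finset.sum_nonpos fun i _ =>
    mul_nonpos_of_nonneg_of_nonpos (hb i) ?_⟩
  · rw [hF, hF, h0, h1, ← hG, ← hG, ← hint, hexact, Finset.mul_sum]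
    refine Finset.sum_congr rfl fun i _ => ?_
    rw [hG', hcolloc, hu_w]
    ring
  · rw [real_inner_comm]
    exact hN i _
end
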